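/- Let G be a prime tournament. Then G is T_5-free and U_5-free if and only if V(G) can be partitioned into sets X, Y, Z such that X ∪ Y, Y ∪ Z, and Z ∪ X are each transitive. -/

import Mathlib

/-- A tournament: irreflexive, and between any two distinct vertices exactly one edge. -/
def IsTournament {V : Type*} (r : V → V → Prop) : Prop :=
  (∀ v, ¬ r v v) ∧ ∀ u v : V, u ≠ v → (r u v ↔ ¬ r v u)

/-- A homogeneous set. -/
def IsHomog {V : Type*} (r : V → V → Prop) (X : Set V) : Prop :=
  ∀ v ∉ X, (∀ x ∈ X, r v x) ∨ (∀ x ∈ X, r x v)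

/-- A prime tournament: every homogeneous set is trivial. -/
def IsPrime {V : Type*} (r : V → V → Prop) : Prop :=
  ∀ X : Set V, IsHomog r X → X.Subsingleton ∨ X = Set.univ

/-- A set of vertices is transitive: it induces no cyclic triangle. -/
def IsTransOn {V : Type*} (r : V → V → Prop) (X : Set V) : Prop :=
  ∀ a ∈ X, ∀ b ∈ X, ∀ c ∈ X, ¬ (r a b ∧ r b c ∧ r c a)

/-- T_5: vertices 0,...,4 (v_k = k-1), with i → j iff j - i ≡ 1 or 2 (mod 5). -/
def T5 (i j : Fin 5) : Prop :=
  (j.val + 5 - i.val) % 5 = 1 ∨ (j.val + 5 - i.val) % 5 = 2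

/-- U_5: obtained from T_5 by reversing the edge between v_1 and v_2
(indices 0 and 1), so that v_2 → v_1. -/
def U5 (i j : Fin 5) : Prop :=
  if i = 0 ∧ j = 1 then False else if i = 1 ∧ j = 0 then True else T5 i j

/-- G (given by relation r) contains a copy of the tournament given by s. -/
def Copy {V W : Type*} (r : V → V → Prop) (s : W → W → Prop) : Prop :=
  ∃ f : W → V, Function.Injective f ∧ ∀ a b, s a b → r (f a) (f b)

section Tournament

variable {V : Type*} {r : V → V → Prop}

theorem IsTournament.asymm (hT : IsTournament r) {a b : V} (h : r a b) : ¬ r b a := by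
  have hne : a ≠ b := by
    rintro rfl
    exact hT.1 _ h
  exact (hT.2 a b hne).1 h

theorem IsTournament.ne (hT : IsTournament r) {a b : V} (h : r a b) : a ≠ b := by
  rintro rfl
  exact hT.1 _ h

theorem IsTournament.total (hT : IsTournament r) {a b : V} (h : a ≠ b) : r a b ∨ r b a := by
  by_cases hab : r b a
  · exact Or.inr hab
  · exact Or.inl ((hT.2 a b h).2 hab)

/-- Strong connectivity of the subtournament on `S`, phrased through cuts. -/
def IsStrongOn (r : V → V → Prop) (S : Set V) : Prop :=
  ∀ A : Set V, (∃ x ∈ S, x ∈ A) → (∃ x ∈ S, x ∉ A) →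
    ∃ x ∈ S, x ∈ A ∧ ∃ y ∈ S, y ∉ A ∧ r x y

theorem isStrongOn_triangle {a b c : V} (hab : r a b) (hbc : r b c) (hca : r c a) :
    IsStrongOn r {a, b, c} := by
  rintro A ⟨x, hx, hxA⟩ ⟨y, hy, hyA⟩
  simp only [Set.mem_insert_iff, Set.mem_singleton_iff, exists_eq_or_imp, exists_eq_left] at *
  grind

theorem IsStrongOn.insert {S : Set V} (hS : IsStrongOn r S) {v a b : V}
    (ha : a ∈ S) (hb : b ∈ S) (hva : r v a) (hbv : r b v) : IsStrongOn r (insert v S) := by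
  rintro A ⟨x, hx, hxA⟩ ⟨y, hy, hyA⟩
  by_cases h₁ : ∃ x ∈ S, x ∈ A
  · by_cases h₂ : ∃ x ∈ S, x ∉ A
    · obtain ⟨x, hxS, hxA, y, hyS, hyA, hxy⟩ := hS A h₁ h₂
      exact ⟨x, Or.inr hxS, hxA, y, Or.inr hyS, hyA, hxy⟩
    · push Not at h₂
      have hyv : y = v := hy.resolve_right fun h => hyA (h₂ y h)
      subst hyv
      exact ⟨b, Or.inr hb, h₂ b hb, y, Or.inl rfl, hyA, hbv⟩
  · push Not at h₁
    have hxv : x = v := hx.resolve_right fun h => h₁ x h hxA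
    subst hxv
    exact ⟨x, Or.inl rfl, hxA, a, Or.inr ha, h₁ a ha, hva⟩

/-- A vertex with both an out-neighbour and an in-neighbour in a strong set closes a cyclic
triangle with an edge of that set. -/
theorem IsStrongOn.exists_edge (hT : IsTournament r) {S : Set V} (hS : IsStrongOn r S) {v a b : V}
    (ha : a ∈ S) (hb : b ∈ S) (hva : r v a) (hbv : r b v) :
    ∃ x ∈ S, ∃ y ∈ S, r v x ∧ r x y ∧ r y v := by
  obtain ⟨x, hx, hvx, y, hy, hvy, hxy⟩ :=
    hS {x | r v x} ⟨a, ha, hva⟩ ⟨b, hb, hT.asymm hbv⟩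
  have hyv : y ≠ v := by
    rintro rfl
    exact hT.asymm hxy hvx
  exact ⟨x, hx, y, hy, hvx, hxy, (hT.total hyv).resolve_right hvy⟩

theorem IsStrongOn.exists_triangle (hT : IsTournament r) {S : Set V} (hS : IsStrongOn r S)
    {p q : V} (hp : p ∈ S) (hq : q ∈ S) (hpq : p ≠ q) :
    ∃ x ∈ S, ∃ y ∈ S, r p x ∧ r x y ∧ r y p := by
  obtain ⟨x, -, rfl, a, ha, -, hpa⟩ := hS {p} ⟨p, hp, rfl⟩ ⟨q, hq, hpq.symm⟩
  obtain ⟨b, hb, -, y, -, hy, hbp⟩ := hS {x}ᶜ ⟨q, hq, hpq.symm⟩ ⟨x, hp, fun h => h rfl⟩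
  have hyx : y = x := not_not.1 hy
  subst hyx
  exact hS.exists_edge hT ha hb hpa hbp

theorem IsPrime.exists_mixed (hT : IsTournament r) (hP : IsPrime r) {S : Set V} {a b c : V}
    (ha : a ∈ S) (hb : b ∈ S) (hab : a ≠ b) (hc : c ∉ S) :
    ∃ v ∉ S, ∃ x ∈ S, ∃ y ∈ S, r v x ∧ r y v := by
  by_contra! hcon
  have hS : IsHomog r S := by
    intro v hv
    by_cases h : ∃ x ∈ S, r v x
    · obtain ⟨x, hx, hvx⟩ := h
      refine Or.inl fun y hy => ?_
      exact (hT.total (by rintro rfl; exact hv hy)).resolve_right (hcon v hv x hx y hy hvx)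
    · push Not at h
      refine Or.inr fun y hy => ?_
      exact (hT.total (by rintro rfl; exact hv hy)).resolve_right (h y hy)
  rcases hP S hS with h | h
  · exact hab (h ha hb)
  · exact hc (h ▸ Set.mem_univ c)

theorem injective_of_edge_preserving (hT : IsTournament r) {W : Type*} {s : W → W → Prop}
    (hs : ∀ a b, a ≠ b → s a b ∨ s b a) {f : W → V} (hf : ∀ a b, s a b → r (f a) (f b)) :
    Function.Injective f := by
  intro a b hab
  by_contra hne
  rcases hs a b hne with h | h
  · exact hT.ne (hf _ _ h) hab
  · exact hT.ne (hf _ _ h) hab.symm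

theorem copy_T5 (hT : IsTournament r) {a b c d e : V} (hab : r a b) (hac : r a c) (hbc : r b c)
    (hbd : r b d) (hcd : r c d) (hce : r c e) (hde : r d e) (hda : r d a) (hea : r e a)
    (heb : r e b) : Copy r T5 := by
  have hf : ∀ i j, T5 i j → r (![a, b, c, d, e] i) (![a, b, c, d, e] j) := by
    intro i j
    fin_cases i <;> fin_cases j <;> simp [T5] <;> assumption
  exact ⟨_, injective_of_edge_preserving hT (by unfold T5; decide) hf, hf⟩

theorem copy_U5 (hT : IsTournament r) {a b c d e : V} (hba : r b a) (hac : r a c) (hbc : r b c)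
    (hbd : r b d) (hcd : r c d) (hce : r c e) (hde : r d e) (hda : r d a) (hea : r e a)
    (heb : r e b) : Copy r U5 := by
  have hf : ∀ i j, U5 i j → r (![a, b, c, d, e] i) (![a, b, c, d, e] j) := by
    intro i j
    fin_cases i <;> fin_cases j <;> simp [U5, T5] <;> assumption
  exact ⟨_, injective_of_edge_preserving hT (by unfold U5 T5; decide) hf, hf⟩

/-- No cyclic triangle contains two vertices that form cyclic triangles with a common edge. -/
def NoTwinTriangle (r : V → V → Prop) : Prop :=
  ∀ p q v y z, r p q → r q v → r v p → r y z → r p y → r z p → r q y → r z q → False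

theorem third_vertex_of_free (hT : IsTournament r) (hT5 : ¬ Copy r T5) (hU5 : ¬ Copy r U5)
    {p q v y z : V} (hpq : r p q) (hqv : r q v) (hvp : r v p) (hyz : r y z) (hpy : r p y)
    (hzp : r z p) (hqy : r q y) (hzq : r z q) : r v y ∧ r z v := by
  have hvy : v ≠ y := by
    rintro rfl
    exact hT.asymm hpy hvp
  have hvz : v ≠ z := by
    rintro rfl
    exact hT.asymm hzq hqv
  rcases hT.total hvy with h₁ | h₁ <;> rcases hT.total hvz with h₂ | h₂
  · exact (hU5 (copy_U5 hT h₁ hyz h₂ hvp hzp hzq hpq hpy hqy hqv)).elim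
  · exact ⟨h₁, h₂⟩
  · exact (hT5 (copy_T5 hT hpq hpy hqy hqv h₁ hyz h₂ hvp hzp hzq)).elim
  · exact (hU5 (copy_U5 hT h₂ hvp hzp hzq hpq hpy hqy hqv h₁ hyz)).elim

theorem IsPrime.noTwinTriangle [Fintype V] (hT : IsTournament r) (hP : IsPrime r)
    (hT5 : ¬ Copy r T5) (hU5 : ¬ Copy r U5) : NoTwinTriangle r := by
  intro p q v y z hpq hqv hvp hyz hpy hzp hqy hzq
  obtain ⟨hvy, hzv⟩ := third_vertex_of_free hT hT5 hU5 hpq hqv hvp hyz hpy hzp hqy hzq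
  let F : Set (Set V) := {M | IsStrongOn r M ∧ ∀ u ∈ M, r u y ∧ r z u}
  have hF : {p, q, v} ∈ F := by
    refine ⟨isStrongOn_triangle hpq hqv hvp, ?_⟩
    rintro u (rfl | rfl | rfl)
    exacts [⟨hpy, hzp⟩, ⟨hqy, hzq⟩, ⟨hvy, hzv⟩]
  obtain ⟨M, hM, hmax⟩ := (Set.toFinite F).exists_le_maximal hF
  have hp : p ∈ M := hM (Or.inl rfl)
  have hq : q ∈ M := hM (Or.inr (Or.inl rfl))
  have hy : y ∉ M := fun h => hT.1 y (hmax.prop.2 y h).1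
  obtain ⟨u, hu, a, ha, b, hb, hua, hbu⟩ := hP.exists_mixed hT hp hq (hT.ne hpq) hy
  obtain ⟨x, hx, x', hx', hux, hxx', hxu⟩ := hmax.prop.1.exists_edge hT ha hb hua hbu
  have hN := third_vertex_of_free hT hT5 hU5 hxx' hxu hux hyz (hmax.prop.2 x hx).1
    (hmax.prop.2 x hx).2 (hmax.prop.2 x' hx').1 (hmax.prop.2 x' hx').2
  have hins : insert u M ∈ F := by
    refine ⟨hmax.prop.1.insert ha hb hua hbu, ?_⟩
    rintro w (rfl | hw)
    exacts [hN, hmax.prop.2 w hw]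
  exact hu (hmax.le_of_ge hins (Set.subset_insert u M) (Set.mem_insert u M))

/-- Every cyclic triangle in `S` runs through the colours in cyclic order. -/
def IsCyclicColoring (r : V → V → Prop) (S : Set V) (col : V → ZMod 3) : Prop :=
  ∀ a ∈ S, ∀ b ∈ S, ∀ c ∈ S, r a b → r b c → r c a → col b = col a + 1

theorem zmod_three_add_one_ne (i : ZMod 3) : i + 1 ≠ i := by decide +revert

theorem zmod_three_add_one_add_one_ne (i : ZMod 3) : i + 1 + 1 ≠ i := by decide +revert

theorem zmod_three_cases (i j : ZMod 3) : j = i ∨ j = i + 1 ∨ j = i + 1 + 1 := by decide +revert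

theorem zmod_three_add_three (i : ZMod 3) : i + 1 + 1 + 1 = i := by decide +revert

theorem IsCyclicColoring.trans (hT : IsTournament r) {S : Set V} {col : V → ZMod 3}
    (hc : IsCyclicColoring r S col) {a b c : V} (ha : a ∈ S) (hb : b ∈ S) (hc' : c ∈ S)
    (hab : r a b) (hbc : r b c) (h : col a = col b ∨ col b = col c ∨ col a = col c) : r a c := by
  have hac : a ≠ c := by
    rintro rfl
    exact hT.asymm hab hbc
  refine (hT.total hac).resolve_right fun hca => ?_
  have h₁ := hc a ha b hb c hc' hab hbc hca
  have h₂ := hc b hb c hc' a ha hbc hca hab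
  have := zmod_three_add_one_ne (col a)
  have := zmod_three_add_one_ne (col a + 1)
  have := zmod_three_add_one_add_one_ne (col a)
  grind

/-- Consecutive vertices of a colour class form cyclic triangles with a common edge. -/
theorem IsCyclicColoring.exists_common_edge (hT : IsTournament r) {S : Set V} {col : V → ZMod 3}
    (hc : IsCyclicColoring r S col) (hS : IsStrongOn r S) {p q : V} (hp : p ∈ S) (hq : q ∈ S)
    (hcol : col q = col p) (hpq : r p q) (hcons : ∀ x ∈ S, col x = col p → r p x → ¬ r x q) :
    ∃ y ∈ S, ∃ z ∈ S, col y = col p + 1 ∧ col z = col p + 1 + 1 ∧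
      r y z ∧ r p y ∧ r z p ∧ r q y ∧ r z q := by
  by_contra! hcon
  obtain ⟨y₀, hy₀, z₀, hz₀, hpy₀, hyz₀, hzp₀⟩ := hS.exists_triangle hT hp hq (hT.ne hpq)
  have hcy₀ := hc p hp y₀ hy₀ z₀ hz₀ hpy₀ hyz₀ hzp₀
  have hcz₀ := hc y₀ hy₀ z₀ hz₀ p hp hyz₀ hzp₀ hpy₀
  have htr := fun {a b c : V} => hc.trans hT (a := a) (b := b) (c := c)
  let L : Set V := {u | col u = col p ∧ r u q ∨ col u = col p + 1 + 1 ∧ r u p ∨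
    col u = col p + 1 ∧ ∃ z ∈ S, col z = col p + 1 + 1 ∧ r z p ∧ r u z}
  have hL : ∀ u, u ∈ L ↔ (col u = col p ∧ r u q ∨ col u = col p + 1 + 1 ∧ r u p ∨
    col u = col p + 1 ∧ ∃ z ∈ S, col z = col p + 1 + 1 ∧ r z p ∧ r u z) := fun _ => Iff.rfl
  have h1 := zmod_three_add_one_ne (col p)
  have h2 := zmod_three_add_one_ne (col p + 1)
  have h3 := zmod_three_add_one_add_one_ne (col p)
  have hqL : q ∉ L := by
    rw [hL]
    have := hT.1 q
    grind
  obtain ⟨a, ha, haL, l, hl, hlL, hal⟩ :=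
    hS Lᶜ ⟨q, hq, hqL⟩ ⟨p, hp, fun h => h (Or.inl ⟨rfl, hpq⟩)⟩
  rw [Set.mem_compl_iff, hL] at haL
  rw [Set.mem_compl_iff, not_not, hL] at hlL
  rcases hlL with ⟨hcl, hlq⟩ | ⟨hcl, hlp⟩ | ⟨hcl, z, hz, hcz, hzp, hlz⟩
  · have hlp : l = p ∨ r l p := by
      by_cases h : l = p
      · exact Or.inl h
      · exact Or.inr ((hT.total h).resolve_right fun h' => hcons l hl hcl h' hlq)
    have hap : r a p := by
      rcases hlp with rfl | hlp
      · exact hal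
      · exact htr ha hl hp hal hlp (by simp [hcl])
    rcases zmod_three_cases (col p) (col a) with h | h | h
    · exact haL (Or.inl ⟨h, htr ha hp hq hap hpq (by simp [h])⟩)
    · have hay : r a y₀ := htr ha hp hy₀ hap hpy₀ (by simp [h, hcy₀])
      have haz : r a z₀ := htr ha hy₀ hz₀ hay hyz₀ (by simp [h, hcy₀])
      exact haL (Or.inr (Or.inr ⟨h, z₀, hz₀, by rw [hcz₀, hcy₀], hzp₀, haz⟩))
    · exact haL (Or.inr (Or.inl ⟨h, hap⟩))
  · rcases zmod_three_cases (col p) (col a) with h | h | h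
    · have hap : r a p := htr ha hl hp hal hlp (by simp [h])
      exact haL (Or.inl ⟨h, htr ha hp hq hap hpq (by simp [h])⟩)
    · exact haL (Or.inr (Or.inr ⟨h, l, hl, hcl, hlp, hal⟩))
    · exact haL (Or.inr (Or.inl ⟨h, htr ha hl hp hal hlp (by simp [h, hcl])⟩))
  · rcases zmod_three_cases (col p) (col a) with h | h | h
    · have hql : r q l := by
        by_cases haq : a = q
        · exact haq ▸ hal
        · have hqa : r q a := (hT.total haq).resolve_left fun h' => haL (Or.inl ⟨h, h'⟩)
          exact htr hq ha hl hqa hal (by simp [h, hcol])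
      have hpl : r p l := htr hp hq hl hpq hql (by simp [hcol])
      exact hcon l hl z hz hcl hcz hlz hpl hzp hql (htr hz hp hq hzp hpq (by simp [hcol]))
    · exact haL (Or.inr (Or.inr ⟨h, z, hz, hcz, hzp, htr ha hl hz hal hlz (by simp [h, hcl])⟩))
    · have haz : r a z := htr ha hl hz hal hlz (by simp [h, hcz])
      exact haL (Or.inr (Or.inl ⟨h, htr ha hz hp haz hzp (by simp [h, hcz])⟩))

/-- A relation between vertices of one colour that survives to one side of every intermediate
vertex holds for some pair that forms cyclic triangles with a common edge. -/
theorem IsCyclicColoring.exists_pair_common_edge [Fintype V] (hT : IsTournament r) {S : Set V}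
    {col : V → ZMod 3} (hc : IsCyclicColoring r S col) (hS : IsStrongOn r S) (i : ZMod 3)
    (P : V → V → Prop)
    (hstep : ∀ p ∈ S, ∀ q ∈ S, ∀ x ∈ S, col p = i → col q = i → col x = i →
      r p q → r p x → r x q → P p q → P p x ∨ P x q)
    {p q : V} (hp : p ∈ S) (hq : q ∈ S) (hcp : col p = i) (hcq : col q = i) (hpq : r p q)
    (hP : P p q) :
    ∃ p ∈ S, ∃ q ∈ S, col p = i ∧ col q = i ∧ r p q ∧ P p q ∧
      ∃ y ∈ S, ∃ z ∈ S, col y = i + 1 ∧ col z = i + 1 + 1 ∧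
        r y z ∧ r p y ∧ r z p ∧ r q y ∧ r z q := by
  induction hn : {x | x ∈ S ∧ col x = i ∧ r p x ∧ r x q}.ncard using Nat.strong_induction_on
    generalizing p q with
  | _ n ih =>
    by_cases hcons : ∃ x ∈ S, col x = i ∧ r p x ∧ r x q
    · obtain ⟨x, hx, hcx, hpx, hxq⟩ := hcons
      rcases hstep p hp q hq x hx hcp hcq hcx hpq hpx hxq hP with h | h
      · refine ih _ ?_ hp hx hcp hcx hpx h rfl
        rw [← hn]
        refine Set.ncard_lt_ncard ((Set.ssubset_iff_of_subset ?_).2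
          ⟨x, ⟨hx, hcx, hpx, hxq⟩, fun h => hT.1 x h.2.2.2⟩) (Set.toFinite _)
        rintro w ⟨hw, hcw, hpw, hwx⟩
        exact ⟨hw, hcw, hpw, hc.trans hT hw hx hq hwx hxq (by simp [hcw, hcx])⟩
      · refine ih _ ?_ hx hq hcx hcq hxq h rfl
        rw [← hn]
        refine Set.ncard_lt_ncard ((Set.ssubset_iff_of_subset ?_).2
          ⟨x, ⟨hx, hcx, hpx, hxq⟩, fun h => hT.1 x h.2.2.1⟩) (Set.toFinite _)
        rintro w ⟨hw, hcw, hxw, hwq⟩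
        exact ⟨hw, hcw, hc.trans hT hp hx hw hpx hxw (by simp [hcw, hcx]), hwq⟩
    · push Not at hcons
      subst hcp
      exact ⟨p, hp, q, hq, rfl, hcq, hpq, hP,
        hc.exists_common_edge hT hS hp hq hcq hpq hcons⟩

section Extension

variable [Fintype V] {S : Set V} {col : V → ZMod 3} {v : V}

theorem IsCyclicColoring.color_ne (hT : IsTournament r) (hF : NoTwinTriangle r)
    (hc : IsCyclicColoring r S col) (hS : IsStrongOn r S) (hv : v ∉ S) {p q : V}
    (hp : p ∈ S) (hq : q ∈ S) (hpq : r p q) (hvp : r v p) (hqv : r q v) : col q ≠ col p := by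
  intro hcol
  obtain ⟨p, -, q, -, -, -, hpq, ⟨hvp, hqv⟩, y, -, z, -, -, -, hyz, hpy, hzp, hqy, hzq⟩ :=
    hc.exists_pair_common_edge hT hS (col p) (fun p q => r v p ∧ r q v)
      (by
        intro p _ q _ x hx _ _ _ _ _ _ h
        rcases hT.total (a := v) (b := x) (by rintro rfl; exact hv hx) with h' | h'
        · exact Or.inr ⟨h', h.2⟩
        · exact Or.inl ⟨h.1, h'⟩) hp hq rfl hcol hpq ⟨hvp, hqv⟩
  exact hF p q v y z hpq hqv hvp hyz hpy hzp hqy hzq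

/-- Within a colour class, the in-neighbours of an outside vertex precede its out-neighbours. -/
theorem IsCyclicColoring.in_beats_out (hT : IsTournament r) (hF : NoTwinTriangle r)
    (hc : IsCyclicColoring r S col) (hS : IsStrongOn r S) (hv : v ∉ S) {a b : V}
    (ha : a ∈ S) (hb : b ∈ S) (hva : r v a) (hbv : r b v) (hcol : col a = col b) : r b a := by
  have hne : b ≠ a := by
    rintro rfl
    exact hT.asymm hva hbv
  exact (hT.total hne).resolve_right
    fun h => hc.color_ne hT hF hS hv ha hb h hva hbv hcol.symm

theorem IsCyclicColoring.color_ne_pred (hT : IsTournament r) (hF : NoTwinTriangle r)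
    (hc : IsCyclicColoring r S col) (hS : IsStrongOn r S) (hv : v ∉ S) {y q : V}
    (hy : y ∈ S) (hq : q ∈ S) (hyq : r y q) (hvy : r v y) (hqv : r q v) :
    col y ≠ col q + 1 := by
  intro hcol
  have htr := fun {a b c : V} => hc.trans hT (a := a) (b := b) (c := c)
  have hv' : ∀ x ∈ S, r v x ∨ r x v := fun x hx =>
    hT.total (by rintro rfl; exact hv hx)
  have hio := fun {a b : V} => hc.in_beats_out hT hF hS hv (a := a) (b := b)
  obtain ⟨z, hz, p, hp, hyz, hzp, hpy⟩ := hS.exists_triangle hT hy hq (hT.ne hyq)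
  have hcp : col p = col q := by
    have := hc p hp y hy z hz hpy hyz hzp
    exact add_right_cancel (this.symm.trans hcol)
  have hpq : r p q := htr hp hy hq hpy hyq (by simp [hcp])
  obtain ⟨p, hp, q, hq, hcp, hcq, hpq, ⟨hpy, hyq, hqv⟩, y₁, hy₁, z, hz, hcy₁, hcz, hyz₁, hpy₁,
      hzp, hqy₁, hzq⟩ :=
    hc.exists_pair_common_edge hT hS (col q) (fun p q => r p y ∧ r y q ∧ r q v)
      (by
        rintro p hp' q' hq' x hx hcp' hcq' hcx - - hxq ⟨hpy', hyq', hqv'⟩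
        have hxy : x ≠ y := by
          rintro rfl
          exact zmod_three_add_one_ne _ (hcol.symm.trans hcx)
        rcases hT.total hxy with h | h
        · exact Or.inr ⟨h, hyq', hqv'⟩
        · refine Or.inl ⟨hpy', h, (hv' x hx).resolve_left fun hvx => ?_⟩
          exact hT.asymm hxq (hio hx hq' hvx hqv' (by rw [hcx, hcq'])))
      hp hq hcp rfl hpq ⟨hpy, hyq, hqv⟩
  have hyy₁ : r y y₁ := htr hy hq hy₁ hyq hqy₁ (by simp [hcol, hcy₁])
  have hyz : r y z := htr hy hy₁ hz hyy₁ hyz₁ (by simp [hcol, hcy₁])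
  have hpv : r p v := (hv' p hp).resolve_left fun h =>
    hT.asymm hpq (hio hp hq h hqv (by rw [hcp, hcq]))
  have hvy₁ : r v y₁ := (hv' y₁ hy₁).resolve_right fun h =>
    hT.asymm hyy₁ (hio hy hy₁ hvy h (by rw [hcol, hcy₁]))
  rcases hv' z hz with h | h
  · exact hF v y q z p hvy hyq hqv hzp h hpv hyz hpy
  · exact hF q v y y₁ z hqv hvy hyq hyz₁ hqy₁ hzq hvy₁ h

theorem IsCyclicColoring.color_succ (hT : IsTournament r) (hF : NoTwinTriangle r)
    (hc : IsCyclicColoring r S col) (hS : IsStrongOn r S) (hv : v ∉ S) {a b : V}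
    (ha : a ∈ S) (hb : b ∈ S) (hab : r a b) (hva : r v a) (hbv : r b v) :
    col b = col a + 1 := by
  rcases zmod_three_cases (col a) (col b) with h | h | h
  · exact (hc.color_ne hT hF hS hv ha hb hab hva hbv h).elim
  · exact h
  · refine (hc.color_ne_pred hT hF hS hv ha hb hab hva hbv ?_).elim
    rw [h, zmod_three_add_three]

theorem IsCyclicColoring.color_ne_succ (hT : IsTournament r) (hF : NoTwinTriangle r)
    (hc : IsCyclicColoring r S col) (hS : IsStrongOn r S) (hv : v ∉ S) {x y y' z : V}
    (hx : x ∈ S) (hy : y ∈ S) (hy' : y' ∈ S) (hz : z ∈ S) (hxy : r x y) (hvx : r v x)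
    (hyv : r y v) (hyz : r y' z) (hvy : r v y') (hzv : r z v) : col y' ≠ col x + 1 := by
  intro hcol
  have htr := fun {a b c : V} => hc.trans hT (a := a) (b := b) (c := c)
  have hv' : ∀ x ∈ S, r v x ∨ r x v := fun x hx =>
    hT.total (by rintro rfl; exact hv hx)
  have hio := fun {a b : V} => hc.in_beats_out hT hF hS hv (a := a) (b := b)
  have hcy := hc.color_succ hT hF hS hv hx hy hxy hvx hyv
  have hcz := hc.color_succ hT hF hS hv hy' hz hyz hvy hzv
  obtain ⟨y, hy, y', hy', hcy, hcy', hyy', ⟨hyv, hvy, hxy, hyz⟩, z', hz', x', hx', hcz', hcx',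
      hzx', hyz', hxy', hyz'', hxy''⟩ :=
    hc.exists_pair_common_edge hT hS (col x + 1)
      (fun y y' => r y v ∧ r v y' ∧ r x y ∧ r y' z)
      (by
        rintro p hp q hq w hw hcp hcq hcw - hpw hwq ⟨h₁, h₂, h₃, h₄⟩
        rcases hv' w hw with h | h
        · exact Or.inl ⟨h₁, h, h₃, htr hw hq hz hwq h₄ (by simp [hcw, hcq])⟩
        · exact Or.inr ⟨h, h₂, htr hx hp hw h₃ hpw (by simp [hcw, hcp]), h₄⟩)
      hy hy' hcy hcol (hio hy' hy hvy hyv (by rw [hcol, hcy])) ⟨hyv, hvy, hxy, hyz⟩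
  rw [zmod_three_add_three] at hcx'
  have hcz : col z = col z' := by rw [hcz, hcz', hcol]
  obtain ⟨w, hw, hcw, hwv, hyw, hwx'⟩ :
      ∃ w ∈ S, col w = col z' ∧ r w v ∧ r y' w ∧ r w x' := by
    rcases hv' z' hz' with h | h
    · exact ⟨z, hz, hcz, hzv, hyz,
        htr hz hz' hx' (hio hz' hz h hzv hcz.symm) hzx' (by simp [hcz])⟩
    · exact ⟨z', hz', rfl, h, hyz'', hzx'⟩
  obtain ⟨u, hu, hcu, hvu, huy, hwu⟩ :
      ∃ u ∈ S, col u = col x ∧ r v u ∧ r u y ∧ r w u := by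
    rcases hv' x' hx' with h | h
    · exact ⟨x', hx', hcx', h, hxy', hwx'⟩
    · exact ⟨x, hx, rfl, hvx, hxy,
        htr hw hx' hx hwx' (hio hx hx' hvx h hcx'.symm) (by simp [hcx'])⟩
  have hyw' : r y w := htr hy hy' hw hyy' hyw (by simp [hcy, hcy'])
  exact hF w v y' u y hwv hvy hyw huy hwu hyw' hvu hyv

theorem IsCyclicColoring.exists_insert (hT : IsTournament r) (hF : NoTwinTriangle r)
    (hc : IsCyclicColoring r S col) (hS : IsStrongOn r S) (hv : v ∉ S) {a b : V}
    (ha : a ∈ S) (hb : b ∈ S) (hab : r a b) (hva : r v a) (hbv : r b v) :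
    ∃ col' : V → ZMod 3, IsCyclicColoring r (insert v S) col' := by
  classical
  have hsucc : ∀ x ∈ S, ∀ y ∈ S, r v x → r x y → r y v → col y = col x + 1 :=
    fun x hx y hy hvx hxy hyv => hc.color_succ hT hF hS hv hx hy hxy hvx hyv
  have huniq : ∀ x ∈ S, ∀ y ∈ S, r v x → r x y → r y v → col x = col a := by
    intro x hx y hy hvx hxy hyv
    rcases zmod_three_cases (col a) (col x) with h | h | h
    · exact h
    · exact (hc.color_ne_succ hT hF hS hv ha hb hx hy hab hva hbv hxy hvx hyv h).elim
    · refine (hc.color_ne_succ hT hF hS hv hx hy ha hb hxy hvx hyv hab hva hbv ?_).elim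
      rw [h, zmod_three_add_three]
  have hne : ∀ x ∈ S, x ≠ v := by
    rintro x hx rfl
    exact hv hx
  refine ⟨Function.update col v (col a + 1 + 1), ?_⟩
  rintro x (rfl | hx) y (rfl | hy) z (rfl | hz) hxy hyz hzx
  · exact (hT.1 _ hxy).elim
  · exact (hT.1 _ hxy).elim
  · exact (hT.1 _ hzx).elim
  · simp [hne y hy, huniq y hy z hz hxy hyz hzx, zmod_three_add_three]
  · exact (hT.1 _ hyz).elim
  · simp [hne x hx, hsucc z hz x hx hyz hzx hxy, huniq z hz x hx hyz hzx hxy]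
  · simp [hne x hx, hne y hy, hsucc x hx y hy hzx hxy hyz]
  · simp [hne x hx, hne y hy, hc x hx y hy z hz hxy hyz hzx]

end Extension

theorem IsPrime.exists_cyclicColoring [Fintype V] (hT : IsTournament r) (hP : IsPrime r)
    (hF : NoTwinTriangle r) {a b c : V} (hab : r a b) (hbc : r b c) (hca : r c a) :
    ∃ col : V → ZMod 3, IsCyclicColoring r Set.univ col := by
  classical
  let F : Set (Set V) := {S | IsStrongOn r S ∧ ∃ col, IsCyclicColoring r S col}
  have hcol : IsCyclicColoring r {a, b, c}
      (fun x => if x = a then 0 else if x = b then 1 else 2) := by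
    have hba := (hT.ne hab).symm
    have hca' := hT.ne hca
    have hcb := (hT.ne hbc).symm
    have e : (2 : ZMod 3) + 1 = 0 := rfl
    have e' : (1 : ZMod 3) + 1 = 2 := rfl
    have hasymm := fun {x y : V} => hT.asymm (a := x) (b := y)
    have hirr := hT.1
    rintro x (rfl | rfl | rfl) y (rfl | rfl | rfl) z - hxy - - <;>
      first
        | exact (hirr _ hxy).elim
        | exact (hasymm hxy hab).elim
        | exact (hasymm hxy hbc).elim
        | exact (hasymm hxy hca).elim
        | simp [hba, hca', hcb, e, e']
  have htri : {a, b, c} ∈ F := ⟨isStrongOn_triangle hab hbc hca, _, hcol⟩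
  obtain ⟨S, hle, hmax⟩ := (Set.toFinite F).exists_le_maximal htri
  obtain ⟨hS, col, hc⟩ := hmax.prop
  suffices S = Set.univ from ⟨col, this ▸ hc⟩
  by_contra hne
  obtain ⟨w, hw⟩ := (Set.ne_univ_iff_exists_notMem S).1 hne
  obtain ⟨v, hv, x, hx, y, hy, hvx, hyv⟩ :=
    hP.exists_mixed hT (hle (Or.inl rfl)) (hle (Or.inr (Or.inl rfl))) (hT.ne hab) hw
  obtain ⟨p, hp, q, hq, hvp, hpq, hqv⟩ := hS.exists_edge hT hx hy hvx hyv
  have hins : insert v S ∈ F :=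
    ⟨hS.insert hx hy hvx hyv, hc.exists_insert hT hF hS hv hp hq hpq hvp hqv⟩
  exact hv (hmax.le_of_ge hins (Set.subset_insert v S) (Set.mem_insert v S))

theorem IsCyclicColoring.isTransOn_union {col : V → ZMod 3}
    (hc : IsCyclicColoring r Set.univ col) {i j : ZMod 3} :
    IsTransOn r ({x | col x = i} ∪ {x | col x = j}) := by
  rintro a ha b hb c hc' ⟨hab, hbc, hca⟩
  have h₁ := hc a trivial b trivial c trivial hab hbc hca
  have h₂ := hc b trivial c trivial a trivial hbc hca hab
  have := zmod_three_add_one_ne (col a)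
  have := zmod_three_add_one_ne (col a + 1)
  have := zmod_three_add_one_add_one_ne (col a)
  simp only [Set.mem_union, Set.mem_ofPred_eq] at ha hb hc'
  grind

theorem exists_rainbow_coloring {X Y Z : Set V} (hU : X ∪ Y ∪ Z = Set.univ)
    (hXY : IsTransOn r (X ∪ Y)) (hYZ : IsTransOn r (Y ∪ Z)) (hZX : IsTransOn r (Z ∪ X)) :
    ∃ col : V → Fin 3, ∀ a b c, r a b → r b c → r c a → col a ≠ col b := by
  classical
  refine ⟨fun v => if v ∈ X then 0 else if v ∈ Y then 1 else 2, fun a b c hab hbc hca => ?_⟩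
  have hmem : ∀ v, v ∈ X ∨ v ∈ Y ∨ v ∈ Z := fun v => by
    have : v ∈ X ∪ Y ∪ Z := hU ▸ Set.mem_univ v
    simpa [or_assoc] using this
  have h₁ := hXY a
  have h₂ := hYZ a
  have h₃ := hZX a
  have ha := hmem a
  have hb := hmem b
  have hc := hmem c
  simp only [Set.mem_union] at h₁ h₂ h₃
  intro h
  dsimp only at h
  have e₁ : (0 : Fin 3) ≠ 1 := by decide
  have e₂ : (0 : Fin 3) ≠ 2 := by decide
  have e₃ : (1 : Fin 3) ≠ 2 := by decide
  split_ifs at h <;> grind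

theorem not_copy_T5_of_rainbow {col : V → Fin 3}
    (h : ∀ a b c, r a b → r b c → r c a → col a ≠ col b) : ¬ Copy r T5 := by
  rintro ⟨f, -, hf⟩
  have hinj : Function.Injective (col ∘ f) := by
    have hT : ∀ i j : Fin 5, i ≠ j → ∃ k, T5 i j ∧ T5 j k ∧ T5 k i ∨ T5 j i ∧ T5 i k ∧ T5 k j := by
      unfold T5
      decide
    intro i j hij
    by_contra hne
    obtain ⟨k, ⟨h₁, h₂, h₃⟩ | ⟨h₁, h₂, h₃⟩⟩ := hT i j hne
    · exact h _ _ _ (hf _ _ h₁) (hf _ _ h₂) (hf _ _ h₃) hij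
    · exact h _ _ _ (hf _ _ h₁) (hf _ _ h₂) (hf _ _ h₃) hij.symm
  have := Fintype.card_le_of_injective _ hinj
  simp at this

theorem not_copy_U5_of_rainbow {col : V → Fin 3}
    (h : ∀ a b c, r a b → r b c → r c a → col a ≠ col b) : ¬ Copy r U5 := by
  rintro ⟨f, -, hf⟩
  have htri : ∀ i j k, U5 i j ∧ U5 j k ∧ U5 k i →
      col (f i) ≠ col (f j) ∧ col (f j) ≠ col (f k) ∧ col (f k) ≠ col (f i) := by
    rintro i j k ⟨h₁, h₂, h₃⟩
    have e₁ := hf _ _ h₁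
    have e₂ := hf _ _ h₂
    have e₃ := hf _ _ h₃
    exact ⟨h _ _ _ e₁ e₂ e₃, h _ _ _ e₂ e₃ e₁, h _ _ _ e₃ e₁ e₂⟩
  have t₁ := htri 0 2 3 (by unfold U5 T5; decide)
  have t₂ := htri 0 2 4 (by unfold U5 T5; decide)
  have t₃ := htri 3 4 1 (by unfold U5 T5; decide)
  omega

end Tournament

/-- Main theorem: a prime tournament is T_5-free and U_5-free iff its vertex
set can be partitioned into X, Y, Z with X ∪ Y, Y ∪ Z, Z ∪ X transitive. -/
theorem prime_free_iff_partition {V : Type*} [Fintype V] (r : V → V → Prop)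
    (hT : IsTournament r) (hP : IsPrime r) :
    (¬ Copy r T5 ∧ ¬ Copy r U5) ↔
      ∃ X Y Z : Set V, X ∪ Y ∪ Z = Set.univ ∧
        Disjoint X Y ∧ Disjoint Y Z ∧ Disjoint Z X ∧
        IsTransOn r (X ∪ Y) ∧ IsTransOn r (Y ∪ Z) ∧ IsTransOn r (Z ∪ X) := by
  constructor
  · rintro ⟨hT5, hU5⟩
    by_cases htri : ∃ a b c, r a b ∧ r b c ∧ r c a
    · obtain ⟨a, b, c, hab, hbc, hca⟩ := htri
      obtain ⟨col, hcol⟩ := hP.exists_cyclicColoring hT (hP.noTwinTriangle hT hT5 hU5) hab hbc hca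
      have hdisj : ∀ i j : ZMod 3, i ≠ j → Disjoint {x | col x = i} {x | col x = j} :=
        fun i j hij => Set.disjoint_left.2 fun x hi hj => hij (hi.symm.trans hj)
      refine ⟨{x | col x = 0}, {x | col x = 1}, {x | col x = 2}, ?_, hdisj _ _ (by decide),
        hdisj _ _ (by decide), hdisj _ _ (by decide), hcol.isTransOn_union,
        hcol.isTransOn_union, hcol.isTransOn_union⟩
      refine Set.eq_univ_of_forall fun x => ?_
      rcases zmod_three_cases 0 (col x) with h | h | h
      · exact Or.inl (Or.inl h)
      · exact Or.inl (Or.inr h)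
      · exact Or.inr h
    · push Not at htri
      have htrans : ∀ X : Set V, IsTransOn r X :=
        fun X a _ b _ c _ h => htri a b c h.1 h.2.1 h.2.2
      exact ⟨Set.univ, ∅, ∅, by simp, by simp, by simp, by simp, htrans _, htrans _, htrans _⟩
  · rintro ⟨X, Y, Z, hU, -, -, -, hXY, hYZ, hZX⟩
    obtain ⟨col, hcol⟩ := exists_rainbow_coloring hU hXY hYZ hZX
    exact ⟨not_copy_T5_of_rainbow hcol, not_copy_U5_of_rainbow hcol⟩
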